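/- arXiv:2311.04785 — 2 statements merged into one kernel-verified Lean document; each statement's English description precedes it below -/
import Mathlib

section
/- Let J : (0,∞) → (0,∞) be the function assigning to each r > 0 the unique positive solution J(r) of (cosh(J) − 1)·(2J + c) = 2·c·r, where c = log(3 + 2√2). Then J(r)/log(r) tends to 1 as r → ∞. -/
open Filter

lemma tendsto_log_cosh_sub_one_mul_div {c : ℝ} (hc : 0 < c) :
    Tendsto (fun x : ℝ => Real.log ((Real.cosh x - 1) * (2 * x + c) / (2 * c)) / x)
      atTop (nhds 1) := by
  have hlog : Tendsto (fun x : ℝ => Real.log x / x) atTop (nhds 0) :=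
    Real.isLittleO_log_id_atTop.tendsto_div_nhds_zero
  have hinv : Tendsto (fun x : ℝ => Real.log 4 / x) atTop (nhds 0) :=
    tendsto_const_nhds.div_atTop tendsto_id
  have hlower : Tendsto (fun x : ℝ => 1 - Real.log 4 / x) atTop (nhds 1) := by
    simpa using hinv.const_sub 1
  have hupper : Tendsto (fun x : ℝ => 1 + 2 * (Real.log x / x)) atTop (nhds 1) := by
    simpa using (hlog.const_mul 2).const_add 1
  have hbounds : ∀ x : ℝ, 3 ≤ x → c ≤ x → 2 / c ≤ x →
      x - Real.log 4 ≤ Real.log ((Real.cosh x - 1) * (2 * x + c) / (2 * c)) ∧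
      Real.log ((Real.cosh x - 1) * (2 * x + c) / (2 * c)) ≤ x + 2 * Real.log x := by
    intro x h3 hcx h2c
    have hexp : 4 ≤ Real.exp x := by linarith [Real.add_one_le_exp x]
    have hneg : Real.exp (-x) ≤ 1 := Real.exp_le_one_iff.mpr (by linarith)
    have hcosh := Real.cosh_eq x
    have hcosh_lower : Real.exp x / 4 ≤ Real.cosh x - 1 := by
      linarith [Real.exp_pos (-x)]
    have hcosh_upper : Real.cosh x - 1 ≤ Real.exp x := by linarith
    have hfac_lower : 1 ≤ (2 * x + c) / (2 * c) := by
      rw [le_div_iff₀ (by positivity)]; linarith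
    have hfac_upper : (2 * x + c) / (2 * c) ≤ x ^ 2 := by
      rw [div_le_iff₀ hc] at h2c
      rw [div_le_iff₀ (by positivity)]
      nlinarith
    have hx : 0 < x := by linarith
    rw [mul_div_assoc]
    constructor
    · rw [Real.le_log_iff_exp_le (by nlinarith), Real.exp_sub, Real.exp_log (by norm_num)]
      nlinarith
    · rw [Real.log_le_iff_le_exp (by nlinarith), Real.exp_add, two_mul (Real.log x), Real.exp_add,
        Real.exp_log hx, ← sq]
      exact mul_le_mul hcosh_upper hfac_upper (by linarith) (Real.exp_pos x).le
  refine tendsto_of_tendsto_of_tendsto_of_le_of_le' hlower hupper ?_ ?_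
  all_goals
    filter_upwards [eventually_ge_atTop 3, eventually_ge_atTop c, eventually_ge_atTop (2 / c)]
      with x h3 hcx h2c
    have hx : 0 < x := by linarith
    obtain ⟨hl, hu⟩ := hbounds x h3 hcx h2c
  · rw [le_div_iff₀ hx, sub_mul, div_mul_cancel₀ _ hx.ne']
    linarith
  · rw [div_le_iff₀ hx, add_mul, mul_assoc, div_mul_cancel₀ _ hx.ne']
    linarith

lemma tendsto_atTop_of_cosh_sub_one_mul_eq {c : ℝ} (hc : 0 < c) {J : ℝ → ℝ}
    (hJpos : ∀ r : ℝ, 0 < r → 0 < J r)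
    (hJeq : ∀ r : ℝ, 0 < r → (Real.cosh (J r) - 1) * (2 * J r + c) = 2 * c * r) :
    Tendsto J atTop atTop := by
  rw [tendsto_atTop]
  intro M
  filter_upwards [eventually_gt_atTop 0,
    eventually_gt_atTop ((Real.cosh M - 1) * (2 * M + c) / (2 * c))] with r hr hrM
  by_contra! h
  have hJ := hJpos r hr
  have hcosh : Real.cosh (J r) ≤ Real.cosh M := by
    rw [Real.cosh_le_cosh, abs_of_pos hJ, abs_of_pos (hJ.trans h)]
    exact h.le
  have hle : (Real.cosh (J r) - 1) * (2 * J r + c) ≤ (Real.cosh M - 1) * (2 * M + c) :=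
    mul_le_mul (by linarith) (by linarith) (by linarith) (by linarith [Real.one_le_cosh M])
  rw [div_lt_iff₀ (by positivity)] at hrM
  linarith [hJeq r hr]

/-- If `J : ℝ → ℝ` assigns to each `r > 0` the (unique) positive solution of
`(cosh (J r) − 1) * (2 * J r + c) = 2 * c * r`, where `c = log (3 + 2√2) = arccosh 3`,
then `J r / log r → 1` as `r → ∞`. -/
theorem J_log_asymptotic
    (c : ℝ) (hc : c = Real.log (3 + 2 * Real.sqrt 2))
    (J : ℝ → ℝ)
    (hJpos : ∀ r : ℝ, 0 < r → 0 < J r)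
    (hJeq : ∀ r : ℝ, 0 < r → (Real.cosh (J r) - 1) * (2 * J r + c) = 2 * c * r) :
    Tendsto (fun r : ℝ => J r / Real.log r) atTop (nhds 1) := by
  have hc0 : 0 < c := hc ▸ Real.log_pos (by linarith [Real.sqrt_nonneg 2])
  have h := ((tendsto_log_cosh_sub_one_mul_div hc0).comp
    (tendsto_atTop_of_cosh_sub_one_mul_eq hc0 hJpos hJeq)).inv₀ one_ne_zero
  rw [inv_one] at h
  refine h.congr' ?_
  filter_upwards [eventually_gt_atTop 0] with r hr
  rw [Function.comp_apply, hJeq r hr, mul_div_cancel_left₀ r (by positivity), inv_div]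
end

section
/- Let M = M₁·M₂·⋯·M_k (k ≥ 1) be any product of the nine letter matrices, and write M = [[a,b],[c,d]] ∈ SL(2,ℂ). Then for every z ∈ ℂ with Re(z) > 0, one has c·z + d ≠ 0 and Re((a·z + b)/(c·z + d)) > 0. That is, every element of the sub-semigroup of SL(2,ℂ) generated by the nine letter matrices induces a Möbius transformation mapping the open right half-plane {Re z > 0} into itself. -/
open Matrix

/-- `S = [[1,1],[0,1]]`. -/
noncomputable def matS : Matrix (Fin 2) (Fin 2) ℂ := !![1, 1; 0, 1]

/-- `R = [[−1,i],[i−1,i]]`. -/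
noncomputable def matR : Matrix (Fin 2) (Fin 2) ℂ :=
  !![-1, Complex.I; Complex.I - 1, Complex.I]

/-- `L = [[i,i],[i+1,1]]`. -/
noncomputable def matL : Matrix (Fin 2) (Fin 2) ℂ :=
  !![Complex.I, Complex.I; Complex.I + 1, 1]

/-- `θ = [[0,i],[i,1]]`. -/
noncomputable def matTheta : Matrix (Fin 2) (Fin 2) ℂ := !![0, Complex.I; Complex.I, 1]

/-- The nine letter matrices `S·θ^j, R·θ^j, L·θ^j` for `j = 0, 1, 2`. -/
noncomputable def letterMatrices : Set (Matrix (Fin 2) (Fin 2) ℂ) :=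
  {M | ∃ j : Fin 3,
    M = matS * matTheta ^ (j : ℕ) ∨ M = matR * matTheta ^ (j : ℕ) ∨
      M = matL * matTheta ^ (j : ℕ)}

/-- The submonoid of complex `2 × 2` matrices preserving the cone of vectors `(u, v)` with
`Re (u * conj v) > 0`, i.e. the homogeneous form of the open right half-plane. -/
def rightHalfPlaneSubmonoid : Submonoid (Matrix (Fin 2) (Fin 2) ℂ) where
  carrier := {M | ∀ x : Fin 2 → ℂ, 0 < (x 0 * star (x 1)).re →
    0 < ((M *ᵥ x) 0 * star ((M *ᵥ x) 1)).re}
  one_mem' x hx := by simpa using hx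
  mul_mem' {M N} hM hN x hx := by
    rw [← mulVec_mulVec]
    exact hM _ (hN x hx)

theorem matS_mem_rightHalfPlaneSubmonoid : matS ∈ rightHalfPlaneSubmonoid := by
  intro x hx
  simp [matS, mulVec, dotProduct, Fin.sum_univ_two] at hx ⊢
  nlinarith [sq_nonneg (x 1).re, sq_nonneg (x 1).im]

theorem matR_mem_rightHalfPlaneSubmonoid : matR ∈ rightHalfPlaneSubmonoid := by
  intro x hx
  simp [matR, mulVec, dotProduct, Fin.sum_univ_two] at hx ⊢
  nlinarith [sq_nonneg ((x 0).re + (x 1).im), sq_nonneg ((x 0).im - (x 1).re)]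

theorem matL_mem_rightHalfPlaneSubmonoid : matL ∈ rightHalfPlaneSubmonoid := by
  intro x hx
  simp [matL, mulVec, dotProduct, Fin.sum_univ_two] at hx ⊢
  nlinarith [sq_nonneg (x 0).re, sq_nonneg (x 0).im]

theorem matTheta_mem_rightHalfPlaneSubmonoid : matTheta ∈ rightHalfPlaneSubmonoid := by
  intro x hx
  simp [matTheta, mulVec, dotProduct, Fin.sum_univ_two] at hx ⊢
  nlinarith

theorem letterMatrices_subset_rightHalfPlaneSubmonoid :
    letterMatrices ⊆ rightHalfPlaneSubmonoid := by
  rintro M ⟨j, rfl | rfl | rfl⟩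
  · exact mul_mem matS_mem_rightHalfPlaneSubmonoid
      (pow_mem matTheta_mem_rightHalfPlaneSubmonoid _)
  · exact mul_mem matR_mem_rightHalfPlaneSubmonoid
      (pow_mem matTheta_mem_rightHalfPlaneSubmonoid _)
  · exact mul_mem matL_mem_rightHalfPlaneSubmonoid
      (pow_mem matTheta_mem_rightHalfPlaneSubmonoid _)

theorem re_div_pos_of_re_mul_star_pos {u v : ℂ} (h : 0 < (u * star v).re) :
    v ≠ 0 ∧ 0 < (u / v).re := by
  have hv : v ≠ 0 := by
    rintro rfl
    simp at h
  refine ⟨hv, ?_⟩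
  have hn := Complex.normSq_pos.mpr hv
  rw [Complex.div_re, ← add_div]
  refine div_pos ?_ hn
  simpa using h

/-- Every nonempty product `M = [[a,b],[c,d]]` of the nine letter matrices induces a Möbius
transformation mapping the open right half-plane `{Re z > 0}` into itself: for every `z`
with `Re z > 0` one has `c·z + d ≠ 0` and `Re ((a·z + b)/(c·z + d)) > 0`. -/
theorem word_maps_right_halfplane_into_itself
    (w : List (Matrix (Fin 2) (Fin 2) ℂ)) (hw : w ≠ [])
    (hmem : ∀ M ∈ w, M ∈ letterMatrices) :
    ∀ z : ℂ, 0 < z.re →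
      w.prod 1 0 * z + w.prod 1 1 ≠ 0 ∧
      0 < ((w.prod 0 0 * z + w.prod 0 1) / (w.prod 1 0 * z + w.prod 1 1)).re := by
  intro z hz
  have hM : w.prod ∈ rightHalfPlaneSubmonoid :=
    list_prod_mem fun M hM => letterMatrices_subset_rightHalfPlaneSubmonoid (hmem M hM)
  have h := hM ![z, 1] (by simpa using hz)
  have h' := re_div_pos_of_re_mul_star_pos h
  simpa [mulVec, dotProduct, Fin.sum_univ_two] using h'
end
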